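/- Let p₁,…,p_l ≥ 1 with k = p₁+⋯+p_l, and let γ ∈ S_k be the permutation with cycles (1,…,p₁)(p₁+1,…,p₁+p₂)⋯(p₁+⋯+p_{l−1}+1,…,k). Then for every partitioned permutation (V,π) of {1,…,k} such that V ∨ C(γ) = 1_k, the triangle inequality |(C(γπ⁻¹), γπ⁻¹)| + |(V,π)| − |(1_k,γ)| ≥ 0 holds (equivalently, (k − #(γπ⁻¹)) + (k − #π) + 2(#π − #V) ≥ (k − #γ) + 2(#γ − 1)), with equality if and only if (V,π) ≤ (1_k,γ). -/

import Mathlib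

open scoped Classical BigOperators
open Filter

noncomputable section

namespace HOF

instance setoidFinite {α : Type*} [Finite α] : Finite (Setoid α) :=
  Finite.of_injective (fun V : Setoid α => V.r)
    (fun V W h => Setoid.ext fun a b => by rw [show V.r = W.r from h])

instance setoidFintype {α : Type*} [Finite α] : Fintype (Setoid α) := Fintype.ofFinite _

instance matrixMeasurableSpace {n : ℕ} : MeasurableSpace (Matrix (Fin n) (Fin n) ℂ) :=
  MeasurableSpace.pi

variable {A : Type*}

/-- Ordered product of the `a i` over the indices in `S`, in increasing order of indices. -/
def ordProd [Monoid A] {l : ℕ} (a : Fin l → A) (S : Set (Fin l)) : A :=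
  (((List.finRange l).filter (fun i => decide (i ∈ S))).map a).prod

/-- The moment functional `E_V` associated to a set partition `V` (encoded as a `Setoid`):
the product over the blocks of `V` of `E` applied to the ordered product over each block. -/
def momentV {R : Type*} [CommRing R] [Monoid A] {l : ℕ} (E : A → R)
    (V : Setoid (Fin l)) (a : Fin l → A) : R :=
  ∏ᶠ B ∈ Setoid.classes V, E (ordProd a B)

/-- `k` is the family of tensor cumulants associated to the expectation `E`:
for every partition `V`, `∑_{W ≤ V} k_W = E_V`. -/
def IsCumulant {R : Type*} [CommRing R] [Monoid A] (E : A → R)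
    (k : ∀ {l : ℕ}, Setoid (Fin l) → (Fin l → A) → R) : Prop :=
  ∀ (l : ℕ) (V : Setoid (Fin l)) (a : Fin l → A),
    ∑ W ∈ Finset.univ.filter (fun W : Setoid (Fin l) => W ≤ V), k W a = momentV E V a

/-- Number of blocks of a partition. -/
def numBlocks {l : ℕ} (V : Setoid (Fin l)) : ℕ := (Setoid.classes V).ncard

/-- The partition of cycles of a permutation. -/
def cycleSetoid {l : ℕ} (π : Equiv.Perm (Fin l)) : Setoid (Fin l) :=
  ⟨π.SameCycle, ⟨fun x => Equiv.Perm.SameCycle.refl π x, fun h => h.symm, fun h h' => h.trans h'⟩⟩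

/-- Number of cycles of a permutation. -/
def numCycles {l : ℕ} (π : Equiv.Perm (Fin l)) : ℕ := numBlocks (cycleSetoid π)

/-- `π ≤ V` : every cycle of `π` is contained in a block of `V`, i.e. `(V, π)` is a
partitioned permutation. -/
def permLePartition {l : ℕ} (π : Equiv.Perm (Fin l)) (V : Setoid (Fin l)) : Prop :=
  ∀ i, V.r i (π i)

/-- Length `|π| = l - #π` of a permutation. -/
def permLen {l : ℕ} (π : Equiv.Perm (Fin l)) : ℤ := (l : ℤ) - numCycles π

/-- Length `|(V,π)| = |π| + 2(#π - #V)` of a partitioned permutation. -/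
def ppLen {l : ℕ} (V : Setoid (Fin l)) (π : Equiv.Perm (Fin l)) : ℤ :=
  ((l : ℤ) - numCycles π) + 2 * ((numCycles π : ℤ) - numBlocks V)

/-- The order `(V,π) ≤ (W,σ)` on partitioned permutations, i.e.
`(V,π) ⬝ (0, π⁻¹σ) = (W,σ)` (with lengths adding up). -/
def ppLe {l : ℕ} (V : Setoid (Fin l)) (π : Equiv.Perm (Fin l))
    (W : Setoid (Fin l)) (σ : Equiv.Perm (Fin l)) : Prop :=
  V ⊔ cycleSetoid (π⁻¹ * σ) = W ∧ ppLen V π + permLen (π⁻¹ * σ) = ppLen W σ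

/-- `(V,π)` and `(W,τ)` are conjugate by the permutation `σ`. -/
def ppConjBy {l : ℕ} (σ : Equiv.Perm (Fin l)) (V : Setoid (Fin l)) (π : Equiv.Perm (Fin l))
    (W : Setoid (Fin l)) (τ : Equiv.Perm (Fin l)) : Prop :=
  τ = σ * π * σ⁻¹ ∧ ∀ a b, W.r a b ↔ V.r (σ⁻¹ a) (σ⁻¹ b)

/-- `(V,π)` and `(W,τ)` are conjugate partitioned permutations. -/
def ppConj {l : ℕ} (V : Setoid (Fin l)) (π : Equiv.Perm (Fin l))
    (W : Setoid (Fin l)) (τ : Equiv.Perm (Fin l)) : Prop :=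
  ∃ σ : Equiv.Perm (Fin l), ppConjBy σ V π W τ

/-- The `(i,j)` entry of `U X U⁻¹ = U X U*` for a unitary `U` (with complex entries) and a
matrix `X` with noncommutative entries. -/
def conjEntry [Ring A] [Algebra ℂ A] {n : ℕ} (U : Matrix (Fin n) (Fin n) ℂ)
    (X : Matrix (Fin n) (Fin n) A) (i j : Fin n) : A :=
  ∑ a : Fin n, ∑ b : Fin n, (U i a * star (U j b)) • X a b

/-- A random matrix with noncommutative entries is unitarily invariant if for every unitary `U`
the joint distribution (all joint moments under `E`) of the entries of `U X U⁻¹` coincides with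
that of the entries of `X`. -/
def UnitarilyInvariant [Ring A] [Algebra ℂ A] (E : A → ℂ) {n : ℕ}
    (X : Matrix (Fin n) (Fin n) A) : Prop :=
  ∀ U ∈ Matrix.unitaryGroup (Fin n) ℂ, ∀ (m : ℕ) (i j : Fin m → Fin n),
    E (List.ofFn (fun t => conjEntry U X (i t) (j t))).prod
      = E (List.ofFn (fun t => X (i t) (j t))).prod

/-- `κ_{(V,π)} = k_V(X_{1π(1)}, …, X_{mπ(m)})`. -/
def kappa {n : ℕ} (k : ∀ {l : ℕ}, Setoid (Fin l) → (Fin l → A) → ℂ)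
    (X : Matrix (Fin n) (Fin n) A) {m : ℕ} (h : m ≤ n)
    (V : Setoid (Fin m)) (π : Equiv.Perm (Fin m)) : ℂ :=
  k V (fun t => X (Fin.castLE h t) (Fin.castLE h (π t)))

/-- The sequence `n ↦ κ_{(V,π)}(X_n)` (with junk value `0` for `n < m`). -/
def kappaSeq {A : ℕ → Type*} (k : ∀ n, ∀ {l : ℕ}, Setoid (Fin l) → (Fin l → A n) → ℂ)
    (X : ∀ n, Matrix (Fin n) (Fin n) (A n)) {m : ℕ}
    (V : Setoid (Fin m)) (π : Equiv.Perm (Fin m)) (n : ℕ) : ℂ :=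
  if h : m ≤ n then kappa (k n) (X n) h V π else 0

/-- Normalized trace of a matrix with entries in a `ℂ`-algebra. -/
def ncTrace [Ring A] [Algebra ℂ A] {n : ℕ} (X : Matrix (Fin n) (Fin n) A) : A :=
  ((n : ℂ)⁻¹) • Matrix.trace X

/-- Partial sums `p₁ + ⋯ + p_j`. -/
def psum {l : ℕ} (p : Fin l → ℕ) (j : ℕ) : ℕ := ∑ i : Fin l, if (i : ℕ) < j then p i else 0

/-- `γ` is the permutation with the cycles `(1,…,p₁)(p₁+1,…,p₁+p₂)⋯`. -/
def IsCycleType {l k : ℕ} (p : Fin l → ℕ) (γ : Equiv.Perm (Fin k)) : Prop :=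
  psum p l = k ∧
  (∀ (j : ℕ), j < l → ∀ t : Fin k, psum p j ≤ (t : ℕ) → (t : ℕ) + 1 < psum p (j + 1) →
    ((γ t : Fin k) : ℕ) = (t : ℕ) + 1) ∧
  (∀ (j : ℕ), j < l → ∀ t : Fin k, (t : ℕ) + 1 = psum p (j + 1) → ((γ t : Fin k) : ℕ) = psum p j)

/-- The section `Fin (m-1) → Fin m` merging `i` and `i+1` (both are hit by `i`). -/
def mergeEmb (m i : ℕ) (_hi : i + 1 < m) (t : Fin (m - 1)) : Fin m :=
  if (t : ℕ) ≤ i then ⟨t, by have := t.isLt; omega⟩ else ⟨(t : ℕ) + 1, by have := t.isLt; omega⟩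

/-- The partition of `{1,…,m-1}` obtained from a partition of `{1,…,m}` by merging the
elements `i` and `i+1` into a single element. -/
def mergeSetoid {m : ℕ} (W : Setoid (Fin m)) (i : ℕ) (hi : i + 1 < m) : Setoid (Fin (m - 1)) :=
  Setoid.comap (mergeEmb m i hi) W

/-- The tuple `(a₁, …, a_{i-1}, [a_i, a_{i+1}], a_{i+2}, …, a_m)` of length `m-1`. -/
def mergeSeq [Ring A] {m : ℕ} (a : Fin m → A) (i : ℕ) (hi : i + 1 < m)
    (t : Fin (m - 1)) : A :=
  if (t : ℕ) < i then a ⟨t, by have := t.isLt; omega⟩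
  else if (t : ℕ) = i then
    a ⟨i, by omega⟩ * a ⟨i + 1, hi⟩ - a ⟨i + 1, hi⟩ * a ⟨i, by omega⟩
  else a ⟨(t : ℕ) + 1, by have := t.isLt; omega⟩


theorem numBlocks_eq_card_quotient {l : ℕ} (V : Setoid (Fin l)) :
    numBlocks V = Nat.card (Quotient V) :=
  (Nat.card_congr (Setoid.quotientEquivClasses V)).symm

theorem numBlocks_anti {l : ℕ} {V W : Setoid (Fin l)} (h : V ≤ W) :
    numBlocks W ≤ numBlocks V := by
  rw [numBlocks_eq_card_quotient, numBlocks_eq_card_quotient]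
  refine Nat.card_le_card_of_surjective (Quotient.map id fun a b hab => h hab) ?_
  rintro ⟨x⟩
  exact ⟨⟦x⟧, rfl⟩

theorem numBlocks_lt {l : ℕ} {V W : Setoid (Fin l)} (h : V ≤ W) {a b : Fin l}
    (hW : W a b) (hV : ¬ V a b) : numBlocks W < numBlocks V := by
  refine lt_of_le_of_ne (numBlocks_anti h) fun heq => hV ?_
  rw [numBlocks_eq_card_quotient, numBlocks_eq_card_quotient] at heq
  have hsurj : Function.Surjective
      (Quotient.map id fun a b hab => h hab : Quotient V → Quotient W) := by
    rintro ⟨x⟩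
    exact ⟨⟦x⟧, rfl⟩
  have hinj := ((Nat.bijective_iff_surjective_and_card _).2 ⟨hsurj, heq.symm⟩).injective
  exact Quotient.exact (hinj (a₁ := ⟦a⟧) (a₂ := ⟦b⟧) (Quotient.sound hW))

theorem numBlocks_le {l : ℕ} (V : Setoid (Fin l)) : numBlocks V ≤ l := by
  rw [numBlocks_eq_card_quotient]
  simpa using Nat.card_le_card_of_surjective (Quotient.mk V) Quotient.mk_surjective

theorem cycleSetoid_le_iff {l : ℕ} {σ : Equiv.Perm (Fin l)} {U : Setoid (Fin l)} :
    cycleSetoid σ ≤ U ↔ permLePartition σ U := by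
  refine ⟨fun h i => h (Equiv.Perm.sameCycle_apply_right.2 (Equiv.Perm.SameCycle.refl σ i)),
    fun h x y hxy => ?_⟩
  obtain ⟨n, -, rfl⟩ := Equiv.Perm.SameCycle.exists_pow_eq' hxy
  induction n with
  | zero => exact U.refl x
  | succ n ih =>
    rw [pow_succ', Equiv.Perm.mul_apply]
    exact U.trans (ih ⟨n, by simp⟩) (h _)

theorem permLePartition_cycleSetoid {l : ℕ} (σ : Equiv.Perm (Fin l)) :
    permLePartition σ (cycleSetoid σ) :=
  cycleSetoid_le_iff.1 le_rfl

theorem permLePartition.mono {l : ℕ} {σ : Equiv.Perm (Fin l)} {V W : Setoid (Fin l)}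
    (hσ : permLePartition σ V) (h : V ≤ W) : permLePartition σ W :=
  fun i => h (hσ i)

theorem permLePartition.mul {l : ℕ} {σ π : Equiv.Perm (Fin l)} {V : Setoid (Fin l)}
    (hσ : permLePartition σ V) (hπ : permLePartition π V) : permLePartition (σ * π) V :=
  fun i => V.trans (hπ i) (hσ (π i))

theorem permLePartition_swap {l : ℕ} {a b : Fin l} {V : Setoid (Fin l)} (h : V a b) :
    permLePartition (Equiv.swap a b) V := by
  intro i
  rcases eq_or_ne i a with rfl | ha
  · rw [Equiv.swap_apply_left]; exact h
  rcases eq_or_ne i b with rfl | hb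
  · rw [Equiv.swap_apply_right]; exact V.symm h
  · rw [Equiv.swap_apply_of_ne_of_ne ha hb]

theorem numBlocks_le_sup_swap {l : ℕ} (V : Setoid (Fin l)) (a b : Fin l) :
    numBlocks V ≤ numBlocks (V ⊔ cycleSetoid (Equiv.swap a b)) + 1 := by
  let f : Fin l → Quotient V := fun x => if V x b then ⟦a⟧ else ⟦x⟧
  have hle : V ⊔ cycleSetoid (Equiv.swap a b) ≤ Setoid.ker f := by
    refine sup_le (fun x y hxy => ?_) (cycleSetoid_le_iff.2 (permLePartition_swap ?_))
    · have hiff : V x b ↔ V y b :=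
        ⟨fun h => V.trans (V.symm hxy) h, fun h => V.trans hxy h⟩
      have hq : (⟦x⟧ : Quotient V) = ⟦y⟧ := Quotient.sound hxy
      change f x = f y
      simp only [f, hiff, hq]
    · change f a = f b
      simp [f]
  refine le_trans ?_ (Nat.add_le_add_right (numBlocks_anti hle) 1)
  rw [numBlocks_eq_card_quotient, numBlocks_eq_card_quotient,
    Nat.card_congr (Setoid.quotientKerEquivRange f), Nat.card_coe_set_eq,
    ← Set.ncard_univ]
  refine le_trans (Set.ncard_le_ncard ?_ (Set.toFinite _))
    (Set.ncard_insert_le (⟦b⟧ : Quotient V) (Set.range f))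
  rintro ⟨x⟩ -
  by_cases hx : V x b
  · exact Or.inl (Quotient.sound hx)
  · exact Or.inr ⟨x, if_neg hx⟩

theorem sameCycle_swap_mul_of_not_sameCycle {α : Type*} [Finite α] [DecidableEq α]
    {π : Equiv.Perm α} {a b : α} (h : ¬ π.SameCycle a b) :
    (Equiv.swap a b * π).SameCycle a b := by
  have key : ∀ n : ℕ, (Equiv.swap a b * π).SameCycle a ((π ^ n) a) := by
    intro n
    induction n with
    | zero => exact Equiv.Perm.SameCycle.refl _ _
    | succ n ih =>
      rcases eq_or_ne ((π ^ (n + 1)) a) a with ha | ha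
      · rw [ha]
      have hb : (π ^ (n + 1)) a ≠ b := fun hb => h ⟨(n + 1 : ℕ), by rw [zpow_natCast, hb]⟩
      have hstep : (Equiv.swap a b * π) ((π ^ n) a) = (π ^ (n + 1)) a := by
        rw [Equiv.Perm.mul_apply, ← Equiv.Perm.mul_apply π, ← pow_succ',
          Equiv.swap_apply_of_ne_of_ne ha hb]
      rw [← hstep]
      exact Equiv.Perm.sameCycle_apply_right.2 ih
  obtain ⟨n, -, hn⟩ := Equiv.Perm.SameCycle.exists_pow_eq'
    (⟨-1, by rw [zpow_neg_one]⟩ : π.SameCycle a (π⁻¹ a))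
  have hs := Equiv.Perm.sameCycle_apply_right.2 (key n)
  rwa [hn, Equiv.Perm.mul_apply, ← Equiv.Perm.mul_apply π, mul_inv_cancel,
    Equiv.Perm.one_apply, Equiv.swap_apply_left] at hs

theorem cycleSetoid_le_sup_swap_mul {l : ℕ} (π : Equiv.Perm (Fin l)) (a b : Fin l) :
    cycleSetoid π ≤
      cycleSetoid (Equiv.swap a b * π) ⊔ cycleSetoid (Equiv.swap a b) := by
  rw [cycleSetoid_le_iff]
  have h := ((permLePartition_cycleSetoid (Equiv.swap a b)).mono
    (le_sup_right (a := cycleSetoid (Equiv.swap a b * π)))).mul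
    ((permLePartition_cycleSetoid (Equiv.swap a b * π)).mono le_sup_left)
  rwa [← mul_assoc, Equiv.swap_mul_self, one_mul] at h

theorem numCycles_swap_mul_le {l : ℕ} (π : Equiv.Perm (Fin l)) (a b : Fin l) :
    numCycles (Equiv.swap a b * π) ≤ numCycles π + 1 :=
  (numBlocks_le_sup_swap _ a b).trans
    (Nat.add_le_add_right (numBlocks_anti (cycleSetoid_le_sup_swap_mul π a b)) 1)

theorem numCycles_swap_mul_lt {l : ℕ} {π : Equiv.Perm (Fin l)} {a b : Fin l}
    (h : ¬ π.SameCycle a b) : numCycles (Equiv.swap a b * π) < numCycles π := by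
  have hab := sameCycle_swap_mul_of_not_sameCycle h
  refine numBlocks_lt (a := a) (b := b) ((cycleSetoid_le_sup_swap_mul π a b).trans ?_) hab h
  exact sup_le le_rfl (cycleSetoid_le_iff.2 (permLePartition_swap hab))

theorem ppLen_mono {l : ℕ} {V W : Setoid (Fin l)} (h : V ≤ W) (π : Equiv.Perm (Fin l)) :
    ppLen V π ≤ ppLen W π := by
  have := numBlocks_anti h
  unfold ppLen
  omega

theorem ppLen_sup_swap_mul_le {l : ℕ} {V : Setoid (Fin l)} {π : Equiv.Perm (Fin l)}
    (hπ : permLePartition π V) (a b : Fin l) :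
    ppLen (V ⊔ cycleSetoid (Equiv.swap a b)) (Equiv.swap a b * π) ≤ ppLen V π + 1 := by
  by_cases hV : V a b
  · rw [sup_eq_left.2 (cycleSetoid_le_iff.2 (permLePartition_swap hV))]
    have := numCycles_swap_mul_le π a b
    unfold ppLen
    omega
  · have h₁ := numBlocks_le_sup_swap V a b
    have h₂ := numCycles_swap_mul_lt (π := π) (a := a) (b := b)
      fun h => hV (cycleSetoid_le_iff.2 hπ h)
    unfold ppLen
    omega

/-- The triangle inequality for multiplying a partitioned permutation by a permutation. -/
theorem ppLen_sup_mul_le {l : ℕ} {V : Setoid (Fin l)} {π : Equiv.Perm (Fin l)}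
    (hπ : permLePartition π V) (σ : Equiv.Perm (Fin l)) :
    ppLen (V ⊔ cycleSetoid σ) (σ * π) ≤ permLen σ + ppLen V π := by
  induction hn : σ.support.card using Nat.strong_induction_on generalizing σ with
  | _ n ih =>
    by_cases hσ : σ = 1
    · subst hσ
      have hbot : cycleSetoid (1 : Equiv.Perm (Fin l)) ≤ V :=
        cycleSetoid_le_iff.2 fun i => V.refl i
      have hcard : numCycles (1 : Equiv.Perm (Fin l)) ≤ l := numBlocks_le _
      rw [sup_eq_left.2 hbot, one_mul]
      unfold permLen
      omega
    · obtain ⟨a, ha⟩ : ∃ a, σ a ≠ a := by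
        by_contra! h
        exact hσ (Equiv.ext h)
      have hinv : Equiv.swap a (σ a) * (Equiv.swap a (σ a) * σ) = σ := by
        rw [← mul_assoc, Equiv.swap_mul_self, one_mul]
      have hlt := Equiv.Perm.card_support_swap_mul ha
      have hcyc : numCycles σ < numCycles (Equiv.swap a (σ a) * σ) := by
        conv_lhs => rw [← hinv]
        refine numCycles_swap_mul_lt fun h => ha ?_
        have hfix : Function.IsFixedPt (Equiv.swap a (σ a) * σ) a := by
          simp [Function.IsFixedPt]
        exact (h.eq_of_left hfix).symm
      have hIH := ih _ (hn ▸ hlt) (Equiv.swap a (σ a) * σ) rfl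
      have hle : permLePartition (Equiv.swap a (σ a) * σ * π)
          (V ⊔ cycleSetoid (Equiv.swap a (σ a) * σ)) :=
        ((permLePartition_cycleSetoid _).mono le_sup_right).mul (hπ.mono le_sup_left)
      have hstep := ppLen_sup_swap_mul_le hle a (σ a)
      rw [← mul_assoc, hinv] at hstep
      have hmono := ppLen_mono (V := V ⊔ cycleSetoid σ)
        (W := V ⊔ cycleSetoid (Equiv.swap a (σ a) * σ) ⊔ cycleSetoid (Equiv.swap a (σ a)))
        (by rw [sup_assoc]; exact sup_le_sup_left (cycleSetoid_le_sup_swap_mul σ a (σ a)) V)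
        (σ * π)
      unfold permLen at hIH ⊢
      omega

theorem numCycles_mul_comm {l : ℕ} (σ π : Equiv.Perm (Fin l)) :
    numCycles (σ * π) = numCycles (π * σ) := by
  have hconj : σ * π = π⁻¹ * (π * σ) * π⁻¹⁻¹ := by group
  unfold numCycles
  rw [numBlocks_eq_card_quotient, numBlocks_eq_card_quotient]
  refine Nat.card_congr (Quotient.congr π fun x y => ?_)
  change (σ * π).SameCycle x y ↔ (π * σ).SameCycle (π x) (π y)
  rw [hconj, Equiv.Perm.sameCycle_conj, inv_inv]

/-- The triangle inequality for partitioned permutations: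
for `(V,π)` with `V ∨ C(γ) = 1_k`, one has `|(0,γπ⁻¹)| + |(V,π)| - |(1_k,γ)| ≥ 0`,
with equality if and only if `(V,π) ≤ (1_k,γ)`. -/
theorem triangle_inequality_partitioned_permutations
    {l kk : ℕ} (hl : 1 ≤ l) (p : Fin l → ℕ) (hp : ∀ i, 1 ≤ p i)
    (hkk : psum p l = kk)
    (γ : Equiv.Perm (Fin kk)) (hγ : IsCycleType p γ)
    (V : Setoid (Fin kk)) (π : Equiv.Perm (Fin kk)) (hVπ : permLePartition π V)
    (hjoin : V ⊔ cycleSetoid γ = ⊤) :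
    0 ≤ permLen (γ * π⁻¹) + ppLen V π - ppLen ⊤ γ
    ∧ (permLen (γ * π⁻¹) + ppLen V π - ppLen ⊤ γ = 0 ↔ ppLe V π ⊤ γ) := by
  have hcomm : permLen (π⁻¹ * γ) = permLen (γ * π⁻¹) := by
    rw [permLen, permLen, numCycles_mul_comm]
  have hsup : ∀ σ : Equiv.Perm (Fin kk),
      permLePartition γ (V ⊔ cycleSetoid σ) → V ⊔ cycleSetoid σ = ⊤ := fun σ h =>
    top_le_iff.1 (hjoin ▸ sup_le le_sup_left (cycleSetoid_le_iff.2 h))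
  have hleft : V ⊔ cycleSetoid (γ * π⁻¹) = ⊤ := hsup _ <| by
    have h := ((permLePartition_cycleSetoid (γ * π⁻¹)).mono
      (le_sup_right (a := V))).mul (hVπ.mono le_sup_left)
    rwa [inv_mul_cancel_right] at h
  have hright : V ⊔ cycleSetoid (π⁻¹ * γ) = ⊤ := hsup _ <| by
    have h := (hVπ.mono le_sup_left).mul
      ((permLePartition_cycleSetoid (π⁻¹ * γ)).mono (le_sup_right (a := V)))
    rwa [mul_inv_cancel_left] at h
  have htri := ppLen_sup_mul_le hVπ (γ * π⁻¹)
  rw [hleft, inv_mul_cancel_right] at htri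
  refine ⟨by omega, fun h => ⟨hright, by omega⟩, fun h => ?_⟩
  have := h.2
  omega

end HOF
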